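/- arXiv:quant-ph/0308029 — 2 statements merged into one kernel-verified Lean document; each statement's English description precedes it below -/
import Mathlib

section
/- Let d ≥ 3 be a prime, F = ℤ/dℤ, let n ≥ d and 0 ≤ κ ≤ n/2 be integers, and let A = {C ⊆ F^n : C is a linear subspace, C ⊆ C^⊥, dim_F C = κ}; assume A is nonempty. With N(Q,S) = |{x ∈ S : P_x = Q}| and N̄(Q) = |A|^{−1}·Σ_{C∈A} N(Q,C^⊥), one has N̄(Q) ≤ |T_Q^n|·d^{−κ+d−1} for every type Q ∈ P_n(F) with Q ≠ P_{0^n}. -/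
/- STATEMENT 8: bound on the ensemble-averaged type spectrum:
   N̄(Q) ≤ |T_Q^n|·d^{−κ+d−1} for every type Q ≠ P_{0ⁿ}. -/

open scoped BigOperators

noncomputable section

/-- Dot product `x·y = Σᵢ xᵢ yᵢ` in `ℤ/dℤ`. -/
def dotp {d n : ℕ} (x y : Fin n → ZMod d) : ZMod d := ∑ i, x i * y i

/-- `C^⊥ = {y : ∀ x ∈ C, x·y = 0}`. -/
def dualSet {d n : ℕ} (C : Set (Fin n → ZMod d)) : Set (Fin n → ZMod d) :=
  {y | ∀ x ∈ C, dotp x y = 0}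

/-- `A = {C : C linear, C ⊆ C^⊥, dim C = κ}`, the self-orthogonal κ-dimensional codes. -/
def Aset (d n κ : ℕ) : Set (Submodule (ZMod d) (Fin n → ZMod d)) :=
  {C | (C : Set (Fin n → ZMod d)) ⊆ dualSet (C : Set (Fin n → ZMod d)) ∧
    Module.finrank (ZMod d) C = κ}

open Classical in
/-- The type (empirical distribution) of a string `y ∈ Yⁿ`. -/
def typeOf {Y : Type*} [Fintype Y] {n : ℕ} (y : Fin n → Y) : Y → ℝ :=
  fun a => ((Finset.univ.filter fun i => y i = a).card : ℝ) / n

/-- `P_n(Y)`, the set of all types of sequences in `Yⁿ`. -/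
def typesSet (Y : Type*) [Fintype Y] (n : ℕ) : Set (Y → ℝ) :=
  {Q | ∃ y : Fin n → Y, Q = typeOf y}

/-- `T_Q^n = {y ∈ Yⁿ : P_y = Q}`, the set of strings of type `Q`. -/
def typeClass {Y : Type*} [Fintype Y] (n : ℕ) (Q : Y → ℝ) : Set (Fin n → Y) :=
  {y | typeOf y = Q}

/-- `N(Q,S) = |{x ∈ S : P_x = Q}|`, the number of strings in `S` of type `Q`. -/
def Ncount {Y : Type*} [Fintype Y] {n : ℕ} (Q : Y → ℝ) (S : Set (Fin n → Y)) : ℕ :=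
  {x ∈ S | typeOf x = Q}.ncard

/-- `N̄(Q) = |A|⁻¹ Σ_{C ∈ A} N(Q, C^⊥)`, the ensemble-averaged type spectrum. -/
def Nbar (d n κ : ℕ) [NeZero d] (Q : ZMod d → ℝ) : ℝ :=
  (((Aset d n κ).ncard : ℝ))⁻¹ *
    ∑ᶠ C ∈ Aset d n κ, (Ncount Q (dualSet (C : Set (Fin n → ZMod d))) : ℝ)

section DotProductIsometry

open Matrix

variable {K ι : Type*} [Field K] [Fintype ι]

/-- Two vectors are isometric if a linear automorphism preserving the dot product maps one to
the other. -/
def DotIsometric (x y : ι → K) : Prop :=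
  ∃ g : (ι → K) ≃ₗ[K] (ι → K), (∀ a b, g a ⬝ᵥ g b = a ⬝ᵥ b) ∧ g x = y

lemma DotIsometric.trans {x y z : ι → K} (hxy : DotIsometric x y) (hyz : DotIsometric y z) :
    DotIsometric x z := by
  obtain ⟨g, hg, rfl⟩ := hxy
  obtain ⟨h, hh, rfl⟩ := hyz
  exact ⟨g.trans h, fun a b => by simp [hh, hg], rfl⟩

lemma dotIsometric_neg (x : ι → K) : DotIsometric x (-x) :=
  ⟨LinearEquiv.neg K, fun a b => by simp, by simp⟩

/-- The reflection in the hyperplane orthogonal to `x - y` maps `x` to `y`. -/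
lemma dotIsometric_of_sub_ne_zero {x y : ι → K} (h : x ⬝ᵥ x = y ⬝ᵥ y)
    (hu : (x - y) ⬝ᵥ (x - y) ≠ 0) : DotIsometric x y := by
  classical
  set u := x - y with hu_def
  let f : Module.Dual K (ι → K) := (2 / (u ⬝ᵥ u)) • dotProductEquiv K ι u
  have hf : ∀ z, f z = 2 / (u ⬝ᵥ u) * (u ⬝ᵥ z) := fun z => by simp [f]
  have hfu : f u = 2 := by rw [hf]; field_simp
  refine ⟨Module.reflection hfu, fun a b => ?_, ?_⟩
  · rw [Module.reflection_apply, Module.reflection_apply, hf, hf]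
    simp only [sub_dotProduct, dotProduct_sub, smul_dotProduct, dotProduct_smul, smul_eq_mul,
      dotProduct_comm a u]
    field_simp
    ring
  · have key : 2 * (u ⬝ᵥ x) = u ⬝ᵥ u := by
      simp only [hu_def, sub_dotProduct, dotProduct_sub, dotProduct_comm y x, ← h]
      ring
    have hfx : f x = 1 := by
      rw [hf, div_mul_eq_mul_div, key, div_self hu]
    rw [Module.reflection_apply, hfx, hu_def]
    simp

lemma dotIsometric_of_isotropic {x y : ι → K} (h2 : (2 : K) ≠ 0) (hx : x ⬝ᵥ x = 0)
    (hy : y ⬝ᵥ y = 0) (hxy : x ⬝ᵥ y ≠ 0) : DotIsometric x y := by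
  apply dotIsometric_of_sub_ne_zero (hx.trans hy.symm)
  have : (x - y) ⬝ᵥ (x - y) = -(2 * (x ⬝ᵥ y)) := by
    simp only [sub_dotProduct, dotProduct_sub, dotProduct_comm y x, hx, hy]
    ring
  rw [this]
  exact neg_ne_zero.2 (mul_ne_zero h2 hxy)

lemma exists_dotProduct_ne_zero {x y : ι → K} (hx : x ≠ 0) (hy : y ≠ 0) :
    ∃ w, x ⬝ᵥ w ≠ 0 ∧ y ⬝ᵥ w ≠ 0 := by
  obtain ⟨u, hu⟩ : ∃ u, x ⬝ᵥ u ≠ 0 := by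
    by_contra! h
    exact hx (dotProduct_eq_zero _ h)
  obtain ⟨v, hv⟩ : ∃ v, y ⬝ᵥ v ≠ 0 := by
    by_contra! h
    exact hy (dotProduct_eq_zero _ h)
  by_cases h1 : y ⬝ᵥ u = 0
  · by_cases h3 : x ⬝ᵥ v = 0
    · exact ⟨u + v, by simpa [dotProduct_add, h3], by simpa [dotProduct_add, h1]⟩
    · exact ⟨v, h3, hv⟩
  · exact ⟨u, hu, h1⟩

/-- Witt's theorem for single vectors. -/
theorem dotIsometric_of_dotProduct_self_eq (h2 : (2 : K) ≠ 0) {x y : ι → K} (hx : x ≠ 0)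
    (hy : y ≠ 0) (h : x ⬝ᵥ x = y ⬝ᵥ y) : DotIsometric x y := by
  by_cases h0 : x ⬝ᵥ x = 0
  · have hy0 : y ⬝ᵥ y = 0 := h ▸ h0
    by_cases hxy : x ⬝ᵥ y = 0
    · obtain ⟨w, hwx, hwy⟩ := exists_dotProduct_ne_zero hx hy
      let z := w - ((w ⬝ᵥ w) / (2 * (x ⬝ᵥ w))) • x
      have hz : z ⬝ᵥ z = 0 := by
        simp only [z, sub_dotProduct, dotProduct_sub, smul_dotProduct, dotProduct_smul,
          smul_eq_mul, dotProduct_comm w x, h0]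
        field_simp
        ring
      have hxz : x ⬝ᵥ z ≠ 0 := by simpa [z, dotProduct_sub, h0]
      have hzy : z ⬝ᵥ y ≠ 0 := by simpa [z, sub_dotProduct, hxy, dotProduct_comm w y]
      exact (dotIsometric_of_isotropic h2 h0 hz hxz).trans
        (dotIsometric_of_isotropic h2 hz hy0 hzy)
    · exact dotIsometric_of_isotropic h2 h0 hy0 hxy
  · by_cases hs : (x - y) ⬝ᵥ (x - y) = 0
    · have hs' : (x - -y) ⬝ᵥ (x - -y) ≠ 0 := by
        intro ht
        apply mul_ne_zero (mul_ne_zero h2 h2) h0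
        calc 2 * 2 * (x ⬝ᵥ x) = (x - y) ⬝ᵥ (x - y) + (x - -y) ⬝ᵥ (x - -y) := by
              simp only [sub_dotProduct, dotProduct_sub, neg_dotProduct, dotProduct_neg, ← h]
              ring
          _ = 0 := by rw [hs, ht, add_zero]
      simpa using (dotIsometric_of_sub_ne_zero (by simpa using h) hs').trans
        (dotIsometric_neg (-y))
    · exact dotIsometric_of_sub_ne_zero h hs

end DotProductIsometry

section SelfOrthogonalCodes

open Matrix

variable {d n κ : ℕ}

lemma mem_dualSet_map_iff (g : (Fin n → ZMod d) ≃ₗ[ZMod d] (Fin n → ZMod d))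
    (hg : ∀ a b, g a ⬝ᵥ g b = a ⬝ᵥ b) (C : Submodule (ZMod d) (Fin n → ZMod d))
    (x : Fin n → ZMod d) :
    g x ∈ dualSet (C.map (g : (Fin n → ZMod d) →ₗ[ZMod d] (Fin n → ZMod d)) :
      Set (Fin n → ZMod d)) ↔ x ∈ dualSet (C : Set (Fin n → ZMod d)) := by
  change (∀ z ∈ _, z ⬝ᵥ g x = 0) ↔ ∀ z ∈ _, z ⬝ᵥ x = 0
  simp [hg]

lemma map_mem_Aset (g : (Fin n → ZMod d) ≃ₗ[ZMod d] (Fin n → ZMod d))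
    (hg : ∀ a b, g a ⬝ᵥ g b = a ⬝ᵥ b) {C : Submodule (ZMod d) (Fin n → ZMod d)}
    (hC : C ∈ Aset d n κ) :
    C.map (g : (Fin n → ZMod d) →ₗ[ZMod d] (Fin n → ZMod d)) ∈ Aset d n κ := by
  refine ⟨?_, (LinearEquiv.finrank_map_eq g C).trans hC.2⟩
  rintro _ ⟨x, hx, rfl⟩
  exact (mem_dualSet_map_iff g hg C x).2 (hC.1 hx)

lemma ncard_Aset_dual_le_of_dotIsometric [Fact d.Prime] {x y : Fin n → ZMod d}
    (h : DotIsometric x y) :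
    {C ∈ Aset d n κ | x ∈ dualSet (C : Set (Fin n → ZMod d))}.ncard ≤
      {C ∈ Aset d n κ | y ∈ dualSet (C : Set (Fin n → ZMod d))}.ncard := by
  obtain ⟨g, hg, rfl⟩ := h
  refine Set.ncard_le_ncard_of_injOn
    (Submodule.map (g : (Fin n → ZMod d) →ₗ[ZMod d] (Fin n → ZMod d))) ?_
    (Submodule.map_injective_of_injective g.injective).injOn (Set.toFinite _)
  rintro C ⟨hC, hx⟩
  exact ⟨map_mem_Aset g hg hC, (mem_dualSet_map_iff g hg C x).2 hx⟩

lemma ncard_dualSet [Fact d.Prime] (C : Submodule (ZMod d) (Fin n → ZMod d)) :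
    (dualSet (C : Set (Fin n → ZMod d))).ncard = d ^ (n - Module.finrank (ZMod d) C) := by
  let D : Submodule (ZMod d) (Fin n → ZMod d) :=
    C.dualAnnihilator.map (dotProductEquiv (ZMod d) (Fin n)).symm.toLinearMap
  have hD : dualSet (C : Set (Fin n → ZMod d)) = D := by
    ext y
    change (∀ z ∈ C, z ⬝ᵥ y = 0) ↔ y ∈ D
    rw [Submodule.mem_map_equiv, Submodule.mem_dualAnnihilator]
    simp [dotProduct_comm]
  have h1 : Module.finrank (ZMod d) D = Module.finrank (ZMod d) C.dualAnnihilator :=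
    LinearEquiv.finrank_map_eq _ _
  have h2 := Subspace.finrank_add_finrank_dualAnnihilator_eq C
  rw [Module.finrank_fin_fun] at h2
  rw [hD, ← Nat.card_coe_set_eq, SetLike.coe_sort_coe,
    Module.natCard_eq_pow_finrank (K := ZMod d), Nat.card_zmod, h1]
  congr 1
  omega

lemma pow_lt_ncard_dotProduct_self_eq [Fact d.Prime] (h2 : (2 : ZMod d) ≠ 0) (m : ℕ)
    (hm : 0 < m) (p : ZMod d) :
    d ^ m < {x : Fin (m + 2) → ZMod d | x ⬝ᵥ x = p}.ncard := by
  choose a b hab using ZMod.sq_add_sq d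
  let f : (Fin m → ZMod d) → Fin (m + 2) → ZMod d := fun v =>
    vecCons (a (p - v ⬝ᵥ v)) (vecCons (b (p - v ⬝ᵥ v)) v)
  have hf : Function.Injective f := fun v w h => by
    simp only [f, vecCons, Fin.cons_inj] at h
    exact h.2.2
  obtain ⟨e, he⟩ : ∃ e : Fin m → ZMod d, p - e ⬝ᵥ e ≠ 0 := by
    by_contra! h
    have h0 := h 0
    have h1 := h (Pi.single ⟨0, hm⟩ 1)
    simp at h0
    simp [h0] at h1
  let w : Fin (m + 2) → ZMod d :=
    vecCons (-a (p - e ⬝ᵥ e)) (vecCons (-b (p - e ⬝ᵥ e)) e)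
  have hw : w ∉ Set.range f := by
    rintro ⟨v, hv⟩
    simp only [f, w, vecCons, Fin.cons_inj] at hv
    obtain ⟨h3, h4, rfl⟩ := hv
    have h5 : a (p - v ⬝ᵥ v) = 0 :=
      (mul_eq_zero.1 (show 2 * a (p - v ⬝ᵥ v) = 0 by linear_combination h3)).resolve_left h2
    have h6 : b (p - v ⬝ᵥ v) = 0 :=
      (mul_eq_zero.1 (show 2 * b (p - v ⬝ᵥ v) = 0 by linear_combination h4)).resolve_left h2
    apply he
    rw [← hab (p - v ⬝ᵥ v), h5, h6]
    ring
  have hsub : insert w (Set.range f) ⊆ {x | x ⬝ᵥ x = p} := by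
    rintro _ (rfl | ⟨v, rfl⟩)
    · simp only [w, Set.mem_ofPred_eq, cons_dotProduct_cons]
      linear_combination hab (p - e ⬝ᵥ e)
    · simp only [f, Set.mem_ofPred_eq, cons_dotProduct_cons]
      linear_combination hab (p - v ⬝ᵥ v)
  have hcard := Set.ncard_le_ncard hsub (Set.toFinite _)
  rw [Set.ncard_insert_of_notMem hw (Set.toFinite _), ← Set.image_univ,
    Set.ncard_image_of_injective _ hf, Set.ncard_univ, Nat.card_fun, Nat.card_zmod,
    Nat.card_fin] at hcard
  exact hcard

lemma pow_le_ncard_ne_zero_dotProduct_self_eq [Fact d.Prime] (h2 : (2 : ZMod d) ≠ 0)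
    (hn : 3 ≤ n) (p : ZMod d) :
    d ^ (n - 2) ≤ {x : Fin n → ZMod d | x ≠ 0 ∧ x ⬝ᵥ x = p}.ncard := by
  obtain ⟨m, rfl⟩ : ∃ m, n = m + 2 := ⟨n - 2, by omega⟩
  have h := pow_lt_ncard_dotProduct_self_eq h2 m (by omega) p
  have hsub : {x : Fin (m + 2) → ZMod d | x ⬝ᵥ x = p} ⊆ insert 0 {x | x ≠ 0 ∧ x ⬝ᵥ x = p} := by
    intro x hx
    by_cases hx0 : x = 0
    · exact Or.inl hx0
    · exact Or.inr ⟨hx0, hx⟩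
  have h3 := Set.ncard_le_ncard hsub (Set.toFinite _)
  have h4 := Set.ncard_insert_le 0 {x : Fin (m + 2) → ZMod d | x ≠ 0 ∧ x ⬝ᵥ x = p}
  simp only [Nat.add_sub_cancel]
  omega

open Finset in
lemma sum_ncard_sep {α β : Type*} [Fintype α] [Fintype β] (r : α → β → Prop) (s : Set α)
    [DecidablePred (· ∈ s)] (t : Set β) [DecidablePred (· ∈ t)] :
    ∑ a ∈ s.toFinset, {b ∈ t | r a b}.ncard = ∑ b ∈ t.toFinset, {a ∈ s | r a b}.ncard := by
  classical
  simp only [Set.ncard_eq_toFinset_card']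
  convert sum_card_bipartiteAbove_eq_sum_card_bipartiteBelow (s := s.toFinset) (t := t.toFinset) r
    using 3 with a _ b _
  · ext; simp
  · ext; simp

lemma ncard_mul_le_ncard_mul {α β : Type*} [Finite α] [Finite β] (r : α → β → Prop) (s : Set α)
    (t : Set β) {k l : ℕ} (hk : ∀ a ∈ s, k ≤ {b ∈ t | r a b}.ncard)
    (hl : ∀ b ∈ t, {a ∈ s | r a b}.ncard ≤ l) : s.ncard * k ≤ t.ncard * l := by
  classical
  have := Fintype.ofFinite α
  have := Fintype.ofFinite β
  rw [Set.ncard_eq_toFinset_card' s, Set.ncard_eq_toFinset_card' t, ← smul_eq_mul, ← smul_eq_mul]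
  refine (Finset.card_nsmul_le_sum _ _ _ fun a ha => hk a (Set.mem_toFinset.1 ha)).trans ?_
  rw [sum_ncard_sep]
  exact Finset.sum_le_card_nsmul _ _ _ fun b hb => hl b (Set.mem_toFinset.1 hb)

lemma pow_mul_ncard_Aset_dual_le [Fact d.Prime] (h2 : (2 : ZMod d) ≠ 0) (hn : 3 ≤ n)
    {x : Fin n → ZMod d} (hx : x ≠ 0) :
    d ^ (n - 2) * {C ∈ Aset d n κ | x ∈ dualSet (C : Set (Fin n → ZMod d))}.ncard ≤
      (Aset d n κ).ncard * d ^ (n - κ) := by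
  refine (Nat.mul_le_mul_right _
    (pow_le_ncard_ne_zero_dotProduct_self_eq h2 hn (x ⬝ᵥ x))).trans ?_
  refine ncard_mul_le_ncard_mul
    (fun y (C : Submodule (ZMod d) (Fin n → ZMod d)) => y ∈ dualSet (C : Set (Fin n → ZMod d)))
    _ _ (fun y hy => ?_) (fun C hC => ?_)
  · exact ncard_Aset_dual_le_of_dotIsometric
      (dotIsometric_of_dotProduct_self_eq h2 hx hy.1 hy.2.symm)
  · rw [← hC.2, ← ncard_dualSet]
    exact Set.ncard_le_ncard (fun y hy => hy.2) (Set.toFinite _)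

lemma Nbar_eq_sum [NeZero d] (Q : ZMod d → ℝ) [DecidablePred (· ∈ typeClass n Q)] :
    Nbar d n κ Q = ((Aset d n κ).ncard : ℝ)⁻¹ * ∑ x ∈ (typeClass n Q).toFinset,
      ({C ∈ Aset d n κ | x ∈ dualSet (C : Set (Fin n → ZMod d))}.ncard : ℝ) := by
  classical
  have := Fintype.ofFinite (Submodule (ZMod d) (Fin n → ZMod d))
  rw [Nbar, finsum_mem_eq_toFinset_sum]
  congr 1
  have h := sum_ncard_sep (fun (C : Submodule (ZMod d) (Fin n → ZMod d)) x =>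
    x ∈ dualSet (C : Set (Fin n → ZMod d))) (Aset d n κ)
    (typeClass n Q)
  rw [← Nat.cast_sum, ← Nat.cast_sum, ← h]
  refine congrArg _ (Finset.sum_congr rfl fun C _ => congrArg Set.ncard ?_)
  ext x
  exact and_comm

end SelfOrthogonalCodes

theorem stmt_8 (d : ℕ) [NeZero d] (hd : d.Prime) (hd3 : 3 ≤ d) (n κ : ℕ)
    (hn : d ≤ n) (hκ : 2 * κ ≤ n) (hA : (Aset d n κ).Nonempty) :
    ∀ Q ∈ typesSet (ZMod d) n, Q ≠ typeOf (0 : Fin n → ZMod d) →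
      Nbar d n κ Q ≤
        ((typeClass n Q).ncard : ℝ) * (d : ℝ) ^ (-(κ : ℝ) + (d : ℝ) - 1) := by
  classical
  intro Q _ hQ
  have : Fact d.Prime := ⟨hd⟩
  have h2 : (2 : ZMod d) ≠ 0 := by
    intro h
    exact absurd (Nat.le_of_dvd two_pos ((ZMod.natCast_eq_zero_iff 2 d).1 (by exact_mod_cast h)))
      (by omega)
  have hd0 : (0 : ℝ) < d := by exact_mod_cast hd.pos
  have hA0 : (0 : ℝ) < (Aset d n κ).ncard := by
    exact_mod_cast (Set.ncard_pos (Set.toFinite _)).2 hA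
  rw [Nbar_eq_sum, inv_mul_le_iff₀ hA0, Set.ncard_eq_toFinset_card' (typeClass n Q),
    mul_left_comm, ← nsmul_eq_mul]
  refine Finset.sum_le_card_nsmul _ _ _ fun x hx => ?_
  rw [Set.mem_toFinset] at hx
  have hx0 : x ≠ 0 := by
    rintro rfl
    exact hQ hx.symm
  have key := pow_mul_ncard_Aset_dual_le (κ := κ) h2 (hd3.trans hn) hx0
  set f := {C ∈ Aset d n κ | x ∈ dualSet (C : Set (Fin n → ZMod d))}.ncard
  have key' : (d : ℝ) ^ (n - 2) * f ≤ (Aset d n κ).ncard * (d : ℝ) ^ (n - κ) := by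
    exact_mod_cast key
  refine le_of_mul_le_mul_left (key'.trans ?_) (pow_pos hd0 (n - 2))
  rw [mul_left_comm, ← Real.rpow_natCast, ← Real.rpow_natCast, ← Real.rpow_add hd0,
    Nat.cast_sub (by omega), Nat.cast_sub (by omega)]
  gcongr
  · exact_mod_cast hd.one_lt.le
  · have : (3 : ℝ) ≤ d := by exact_mod_cast hd3
    push_cast
    linarith

end
end

section
/- Let d ≥ 3 be a prime, F = ℤ/dℤ, and let 0 ≤ R ≤ 1. Then there exist a polynomial f and ν₀ such that for every ν ≥ ν₀ there exist a self-orthogonal linear code C_ν ⊆ F^{2ν} with 2ν − 2·dim_F C_ν ≥ 2νR and a transversal Γ_ν of F^{2ν}/C_ν^⊥, such that, setting Γ'_ν = Γ_ν + C_ν = {γ + c : γ ∈ Γ_ν, c ∈ C_ν}, for all probability distributions P₀ and P₁ on F×F one has (P̄₀^ν × P̄₁^ν)(F^{2ν} ∖ Γ'_ν) + (P̿₀^ν × P̿₁^ν)(F^{2ν} ∖ Γ'_ν) ≤ f(ν)·d^{−2ν·E_c(R,P₀,P₁)}, where E_c(R,P₀,P₁) = min{E*_c(R,P̄₀,P̄₁),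 E*_c(R,P̿₀,P̿₁)} and E*_c(R,p₀,p₁) = inf over pairs of probability distributions (Q₀,Q₁) on F of (1/2)·[D(Q₀‖p₀) + D(Q₁‖p₁) + max{1 − (H(Q₀)+H(Q₁)) − R, 0}]. -/
/- STATEMENT 12 (Theorem 2: minimum conditional entropy decoding): for primes d ≥ 3
   there are self-orthogonal codes C_ν ⊆ F^{2ν} and transversals Γ_ν such that, with
   Γ'_ν = Γ_ν + C_ν,
   (P̄₀^ν × P̄₁^ν)(F^{2ν}∖Γ'_ν) + (P̿₀^ν × P̿₁^ν)(F^{2ν}∖Γ'_ν) ≤ f(ν)·d^{−2ν·E_c(R,P₀,P₁)}. -/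

open scoped BigOperators

noncomputable section

/-- A transversal of `Fⁿ/C^⊥`: contains exactly one element of each coset of `C^⊥`. -/
def IsTransversal {d n : ℕ} (C : Set (Fin n → ZMod d)) (Γ : Set (Fin n → ZMod d)) : Prop :=
  ∀ y : Fin n → ZMod d, ∃! g, g ∈ Γ ∧ y - g ∈ dualSet C

/-- Probability distribution on a finite set. -/
def IsProbDist {Y : Type*} [Fintype Y] (p : Y → ℝ) : Prop :=
  (∀ a, 0 ≤ p a) ∧ ∑ a, p a = 1

/-- First marginal `P̄(i) = Σ_j P(i,j)`. -/
def margin1 {Y : Type*} [Fintype Y] (P : Y × Y → ℝ) : Y → ℝ := fun i => ∑ j, P (i, j)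

/-- Second marginal `P̿(i) = Σ_j P(j,i)`. -/
def margin2 {Y : Type*} [Fintype Y] (P : Y × Y → ℝ) : Y → ℝ := fun i => ∑ j, P (j, i)

open Classical in
/-- `(p^ν × q^ν)(S) = Σ_{y∈S} p(y₁)⋯p(y_ν)·q(y_{ν+1})⋯q(y_{2ν})` for `S ⊆ F^{2ν}`. -/
def pn2 {Y : Type*} [Fintype Y] (ν : ℕ) (p q : Y → ℝ) (S : Set (Fin (2 * ν) → Y)) : ℝ :=
  ∑ y : Fin (2 * ν) → Y, if y ∈ S then
    ∏ i : Fin (2 * ν), (if (i : ℕ) < ν then p (y i) else q (y i)) else 0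

/-- Base-`d` entropy `H(Q) = −Σ_a Q(a) log_d Q(a)`. -/
def entd (d : ℕ) {Y : Type*} [Fintype Y] (Q : Y → ℝ) : ℝ := -∑ a, Q a * Real.logb d (Q a)

/-- Base-`d` Kullback–Leibler divergence `D(Q‖p) = Σ_a Q(a) log_d (Q(a)/p(a))`. -/
def kld (d : ℕ) {Y : Type*} [Fintype Y] (Q p : Y → ℝ) : ℝ := ∑ a, Q a * Real.logb d (Q a / p a)

/-- `E*_c(R,p₀,p₁) = inf_{(Q₀,Q₁)} ½[D(Q₀‖p₀)+D(Q₁‖p₁)+|1−(H(Q₀)+H(Q₁))−R|⁺]`, over pairs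
of probability distributions on `ℤ/dℤ` (pairs not absolutely continuous contribute `+∞`). -/
def EstarC (d : ℕ) [NeZero d] (R : ℝ) (p₀ p₁ : ZMod d → ℝ) : ℝ :=
  sInf {v : ℝ | ∃ Q₀ Q₁ : ZMod d → ℝ, IsProbDist Q₀ ∧ IsProbDist Q₁ ∧
    (∀ a, p₀ a = 0 → Q₀ a = 0) ∧ (∀ a, p₁ a = 0 → Q₁ a = 0) ∧
    v = 2⁻¹ * (kld d Q₀ p₀ + kld d Q₁ p₁ + max (1 - (entd d Q₀ + entd d Q₁) - R) 0)}

/-- `E_c(R,P₀,P₁) = min{E*_c(R,P̄₀,P̄₁), E*_c(R,P̿₀,P̿₁)}`. -/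
def Ec (d : ℕ) [NeZero d] (R : ℝ) (P₀ P₁ : ZMod d × ZMod d → ℝ) : ℝ :=
  min (EstarC d R (margin1 P₀) (margin1 P₁)) (EstarC d R (margin2 P₀) (margin2 P₁))

/-- If `φ ∘ s` is injective, every fibre of `φ` has at most `|A| / |X|` elements. -/
theorem card_fiber_mul_card_le {A B X : Type*} [AddCommGroup A] [AddCommGroup B] [Fintype A]
    [Fintype X] [DecidableEq B] (φ : A →+ B) (s : X → A)
    (hs : Function.Injective fun x => φ (s x)) (b : B) :
    (Finset.univ.filter fun a => φ a = b).card * Fintype.card X ≤ Fintype.card A := by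
  classical
  rw [← Finset.card_univ (α := X), ← Finset.card_product, ← Finset.card_univ (α := A)]
  refine Finset.card_le_card_of_injOn (fun q => q.1 + s q.2) (by simp) ?_
  rintro ⟨a, x⟩ h ⟨a', x'⟩ h' e
  simp only [Finset.coe_product, Finset.coe_filter, Finset.mem_univ, true_and, Finset.coe_univ,
    Set.mem_prod, Set.mem_ofPred_eq, Set.mem_univ, and_true] at h h' e
  have e' := congrArg φ e
  rw [map_add, map_add, h, h', add_right_inj] at e'
  obtain rfl := hs e'
  simpa using e

open Matrix

section Counting
variable {F ι κ τ : Type*} [Field F] [Fintype F] [DecidableEq F] [Fintype ι] [DecidableEq ι]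
  [Fintype κ] [DecidableEq κ]

theorem card_transpose_mulVec_eq_le [Fintype τ] [DecidableEq τ] {v : κ → F} (hv : v ≠ 0)
    (b : τ → F) :
    (Finset.univ.filter fun G : Matrix κ τ F => Gᵀ *ᵥ v = b).card
      * Fintype.card F ^ Fintype.card τ ≤ Fintype.card (Matrix κ τ F) := by
  obtain ⟨j, hj⟩ := Function.ne_iff.mp hv
  let φ : Matrix κ τ F →+ (τ → F) :=
    { toFun := fun G => Gᵀ *ᵥ v
      map_zero' := by simp
      map_add' := by simp [add_mulVec] }
  have := card_fiber_mul_card_le φ (fun u : τ → F => vecMulVec (Pi.single j 1) u) (by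
    intro u u' h
    ext i
    have := congrFun h i
    simpa [φ, mulVec, dotProduct, vecMulVec_apply, Pi.single_apply, show v j ≠ 0 from hj]
      using this) b
  simpa [φ] using this

theorem card_skew_mulVec_eq_le {v : ι → F} (hv : v ≠ 0) (b : ι → F) :
    (Finset.univ.filter fun A : Matrix ι ι F => (A - Aᵀ) *ᵥ v = b).card
      * Fintype.card F ^ (Fintype.card ι - 1) ≤ Fintype.card (Matrix ι ι F) := by
  obtain ⟨j, hj⟩ := Function.ne_iff.mp hv
  let φ : Matrix ι ι F →+ (ι → F) :=
    { toFun := fun A => (A - Aᵀ) *ᵥ v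
      map_zero' := by simp
      map_add' := fun A B => by simp only [transpose_add, add_sub_add_comm, add_mulVec] }
  have := card_fiber_mul_card_le φ
    (fun u : {i // i ≠ j} → F => Matrix.of fun r c =>
      if h : r ≠ j then (if c = j then u ⟨r, h⟩ else 0) else 0) (by
    intro u u' h
    ext ⟨i, hi⟩
    have := congrFun h i
    simpa [φ, mulVec, dotProduct, hi, show v j ≠ 0 from hj, sub_mul] using this) b
  simpa [φ, Fintype.card_subtype_compl] using this

end Counting

/-- The columns of `α` and `β` are dual bases of complementary isotropic subspaces, and those of `γ`
form an orthonormal basis of the orthogonal complement. -/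
structure IsHyperbolicFrame {F σ ι κ : Type*} [CommRing F] [Fintype σ] [DecidableEq σ]
    [Fintype ι] [DecidableEq ι] [Fintype κ] [DecidableEq κ]
    (α β : Matrix σ ι F) (γ : Matrix σ κ F) : Prop where
  αα : αᵀ * α = 0
  ββ : βᵀ * β = 0
  αβ : αᵀ * β = 1
  γα : γᵀ * α = 0
  γβ : γᵀ * β = 0
  γγ : γᵀ * γ = 1
  total : α * βᵀ + β * αᵀ + γ * γᵀ = 1

open Kronecker in
theorem exists_isHyperbolicFrame {F : Type*} [Field F] (h2 : (2 : F) ≠ 0)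
    (hsq : ∃ a b : F, a ^ 2 + b ^ 2 = -1) (m w n : ℕ) (hn : n = 4 * m + w) :
    ∃ (α β : Matrix (Fin n) (Fin m × Fin 2) F) (γ : Matrix (Fin n) (Fin w) F),
      IsHyperbolicFrame α β γ := by
  obtain ⟨a, b, hab⟩ := hsq
  let e : Fin n ≃ (Fin m × Fin 4) ⊕ Fin w := Fintype.equivOfCardEq (by simp [hn]; ring)
  let A : Matrix (Fin 4) (Fin 2) F := !![1, 0; 0, 1; a, -b; b, a]
  let B : Matrix (Fin 4) (Fin 2) F := !![2⁻¹, 0; 0, 2⁻¹; -a/2, b/2; -b/2, -a/2]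
  have hAA : Aᵀ * A = 0 := by
    ext i j
    rw [mul_apply]
    fin_cases i <;> fin_cases j <;> simp [A, Fin.sum_univ_succ] <;> grind
  have hBB : Bᵀ * B = 0 := by
    ext i j
    rw [mul_apply]
    fin_cases i <;> fin_cases j <;> simp [B, Fin.sum_univ_succ] <;> grind
  have hAB : Aᵀ * B = 1 := by
    ext i j
    rw [mul_apply]
    fin_cases i <;> fin_cases j <;> simp [A, B, Fin.sum_univ_succ] <;> grind
  have hT : A * Bᵀ + B * Aᵀ = 1 := by
    ext i j
    rw [Matrix.add_apply, mul_apply, mul_apply]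
    fin_cases i <;> fin_cases j <;> simp [A, B, Fin.sum_univ_succ] <;> grind
  let α : Matrix ((Fin m × Fin 4) ⊕ Fin w) (Fin m × Fin 2) F := fromRows (1 ⊗ₖ A) 0
  let β : Matrix ((Fin m × Fin 4) ⊕ Fin w) (Fin m × Fin 2) F := fromRows (1 ⊗ₖ B) 0
  let γ : Matrix ((Fin m × Fin 4) ⊕ Fin w) (Fin w) F := fromRows 0 1
  have hK (X : Matrix (Fin 4) (Fin 2) F) :
      ((1 : Matrix (Fin m) (Fin m) F) ⊗ₖ X)ᵀ = 1 ⊗ₖ Xᵀ := by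
    rw [← kroneckerMap_transpose, transpose_one]
  have htotal : α * βᵀ + β * αᵀ + γ * γᵀ = 1 := by
    simp only [α, β, γ, transpose_fromRows, hK, fromRows_mul_fromCols, ← mul_kronecker_mul]
    rw [fromBlocks_add, fromBlocks_add]
    simp [← kronecker_add, hT]
  refine ⟨α.submatrix e id, β.submatrix e id, γ.submatrix e id, ?_, ?_, ?_, ?_, ?_, ?_, ?_⟩
  case refine_7 =>
    have := congrArg (fun X => X.submatrix e e) htotal
    simpa only [submatrix_add, Pi.add_apply, submatrix_mul _ _ e id e Function.bijective_id,
      transpose_submatrix, submatrix_one_equiv] using this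
  all_goals
    simp [α, β, γ, transpose_fromRows, hK, fromCols_mul_fromRows, ← mul_kronecker_mul, hAA, hBB,
      hAB]

section Ensemble
variable {F σ ι κ : Type*} [Field F] [Fintype σ] [DecidableEq σ]
    [Fintype ι] [DecidableEq ι] [Fintype κ] [DecidableEq κ]

/-- A matrix whose column space is isotropic when `α`, `β`, `γ` form a hyperbolic frame. -/
def isotropicMatrix (α β : Matrix σ ι F) (γ : Matrix σ κ F) (A : Matrix ι ι F)
    (T : Matrix κ ι F) : Matrix σ ι F :=
  α + β * ((A - Aᵀ) - (2⁻¹ : F) • (Tᵀ * T)) + γ * T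

variable {α β : Matrix σ ι F} {γ : Matrix σ κ F}

theorem IsHyperbolicFrame.isotropicMatrix_transpose_mul_self (h : IsHyperbolicFrame α β γ)
    (h2 : (2 : F) ≠ 0) (A : Matrix ι ι F) (T : Matrix κ ι F) :
    (isotropicMatrix α β γ A T)ᵀ * isotropicMatrix α β γ A T = 0 := by
  have hβα : βᵀ * α = 1 := by simpa using congrArg transpose h.αβ
  have hαγ : αᵀ * γ = 0 := by simpa using congrArg transpose h.γα
  have hβγ : βᵀ * γ = 0 := by simpa using congrArg transpose h.γβ
  have e : isotropicMatrix α β γ A T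
      = α + β * ((A - Aᵀ) - (2⁻¹ : F) • (Tᵀ * T)) + γ * T := rfl
  set S := (A - Aᵀ) - (2⁻¹ : F) • (Tᵀ * T) with hS
  have hSS : S + Sᵀ + Tᵀ * T = 0 := by
    have : (2⁻¹ : F) • (Tᵀ * T) + (2⁻¹ : F) • (Tᵀ * T) = Tᵀ * T := by
      rw [← add_smul, ← two_mul, mul_inv_cancel₀ h2, one_smul]
    simp only [hS, transpose_sub, transpose_smul, transpose_mul, transpose_transpose]
    generalize (2⁻¹ : F) • (Tᵀ * T) = X at this ⊢
    rw [← this]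
    abel
  have k1 : αᵀ * (β * S) = S := by rw [← Matrix.mul_assoc, h.αβ, Matrix.one_mul]
  have k2 : βᵀ * (β * S) = 0 := by rw [← Matrix.mul_assoc, h.ββ, Matrix.zero_mul]
  have k3 : γᵀ * (β * S) = 0 := by rw [← Matrix.mul_assoc, h.γβ, Matrix.zero_mul]
  have k4 : αᵀ * (γ * T) = 0 := by rw [← Matrix.mul_assoc, hαγ, Matrix.zero_mul]
  have k5 : βᵀ * (γ * T) = 0 := by rw [← Matrix.mul_assoc, hβγ, Matrix.zero_mul]
  have k6 : γᵀ * (γ * T) = T := by rw [← Matrix.mul_assoc, h.γγ, Matrix.one_mul]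
  rw [e, ← hSS]
  simp only [transpose_add, transpose_mul, Matrix.add_mul, Matrix.mul_add, Matrix.mul_assoc, h.αα,
    hβα, h.γα, k1, k2, k3, k4, k5, k6, Matrix.mul_zero, Matrix.mul_one]
  abel

theorem IsHyperbolicFrame.card_isotropicMatrix_le [Fintype F] [DecidableEq F]
    (h : IsHyperbolicFrame α β γ) {z : σ → F} (hz : z ≠ 0) :
    (Finset.univ.filter fun AT : Matrix ι ι F × Matrix κ ι F =>
        (isotropicMatrix α β γ AT.1 AT.2)ᵀ *ᵥ z = 0).card * Fintype.card F ^ (Fintype.card ι - 1)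
      ≤ Fintype.card (Matrix ι ι F) * Fintype.card (Matrix κ ι F) := by
  have key (A : Matrix ι ι F) (T : Matrix κ ι F) : (isotropicMatrix α β γ A T)ᵀ *ᵥ z
      = αᵀ *ᵥ z - (A - Aᵀ) *ᵥ (βᵀ *ᵥ z) - ((2⁻¹ : F) • (Tᵀ * T)) *ᵥ (βᵀ *ᵥ z)
        + Tᵀ *ᵥ (γᵀ *ᵥ z) := by
    simp only [isotropicMatrix, transpose_add, transpose_mul, transpose_sub, transpose_smul,
      transpose_transpose, add_mulVec, ← mulVec_mulVec, sub_mulVec]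
    abel
  have hz' : z = α *ᵥ (βᵀ *ᵥ z) + β *ᵥ (αᵀ *ᵥ z) + γ *ᵥ (γᵀ *ᵥ z) := by
    simp only [mulVec_mulVec, ← add_mulVec, h.total, one_mulVec]
  simp only [key]
  by_cases hb : βᵀ *ᵥ z = 0
  · simp only [hb, mulVec_zero, sub_zero]
    by_cases hg : γᵀ *ᵥ z = 0
    · have ha : αᵀ *ᵥ z ≠ 0 := by
        intro ha
        rw [ha, hb, hg] at hz'
        simp at hz'
        exact hz hz'
      simp [hg, ha]
    · have := card_transpose_mulVec_eq_le (τ := ι) hg (-(αᵀ *ᵥ z))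
      have e : (Finset.univ.filter fun AT : Matrix ι ι F × Matrix κ ι F =>
          αᵀ *ᵥ z + AT.2ᵀ *ᵥ (γᵀ *ᵥ z) = 0) = Finset.univ ×ˢ
            Finset.univ.filter fun T : Matrix κ ι F => Tᵀ *ᵥ (γᵀ *ᵥ z) = -(αᵀ *ᵥ z) := by
        ext ⟨A, T⟩
        simp [add_eq_zero_iff_neg_eq, eq_comm]
      rw [e, Finset.card_product, Finset.card_univ, mul_assoc]
      refine Nat.mul_le_mul_left _ (le_trans (Nat.mul_le_mul_left _ ?_) this)
      exact Nat.pow_le_pow_right Fintype.card_pos (Nat.sub_le _ _)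
  · rw [Finset.card_filter, Fintype.sum_prod_type_right, Finset.sum_mul, mul_comm (Fintype.card _),
      ← smul_eq_mul (Fintype.card _), ← Finset.card_univ (α := Matrix κ ι F), ← Finset.sum_const]
    refine Finset.sum_le_sum fun T _ => ?_
    rw [← Finset.card_filter]
    refine le_trans (le_of_eq ?_) (card_skew_mulVec_eq_le hb
      (αᵀ *ᵥ z - ((2⁻¹ : F) • (Tᵀ * T)) *ᵥ (βᵀ *ᵥ z) + Tᵀ *ᵥ (γᵀ *ᵥ z)))
    congr 3
    ext A
    rw [eq_comm (b := αᵀ *ᵥ z - _ + _), ← sub_eq_zero (b := (A - Aᵀ) *ᵥ _)]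
    refine Eq.congr ?_ rfl
    abel

theorem IsHyperbolicFrame.card_code_le [Fintype F] [DecidableEq F]
    (h : IsHyperbolicFrame α β γ) {z : σ → F} (hz : z ≠ 0) {k : ℕ}
    (hk : k ≤ Fintype.card ι - 1 + 2) :
    (Finset.univ.filter fun ω : (Matrix ι ι F × Matrix κ ι F) × Matrix ι (Fin k) F =>
        (isotropicMatrix α β γ ω.1.1 ω.1.2 * ω.2)ᵀ *ᵥ z = 0).card * Fintype.card F ^ k
      ≤ (Fintype.card F ^ 2 + 1) *
        Fintype.card ((Matrix ι ι F × Matrix κ ι F) × Matrix ι (Fin k) F) := by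
  set q := Fintype.card F
  set P : Finset (Matrix ι ι F × Matrix κ ι F) := Finset.univ.filter fun AT =>
        (isotropicMatrix α β γ AT.1 AT.2)ᵀ *ᵥ z = 0 with hP
  have h1 := h.card_isotropicMatrix_le hz
  rw [← Fintype.card_prod, ← hP] at h1
  have hq : q ^ k ≤ q ^ (Fintype.card ι - 1) * q ^ 2 := by
    rw [← pow_add]
    exact Nat.pow_le_pow_right Fintype.card_pos hk
  set g := Fintype.card (Matrix ι (Fin k) F)
  rw [Finset.card_filter, Fintype.sum_prod_type, Finset.sum_mul]
  have h2 (AT : Matrix ι ι F × Matrix κ ι F) :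
      (∑ G : Matrix ι (Fin k) F,
        if (isotropicMatrix α β γ AT.1 AT.2 * G)ᵀ *ᵥ z = 0 then 1 else 0) * q ^ k
      ≤ g + if (isotropicMatrix α β γ AT.1 AT.2)ᵀ *ᵥ z = 0 then g * q ^ k else 0 := by
    simp only [transpose_mul, ← mulVec_mulVec]
    split_ifs with h0
    · simp [h0, g]
    · rw [← Finset.card_filter, add_zero]
      simpa using card_transpose_mulVec_eq_le (τ := Fin k) h0 0
  calc _ ≤ ∑ AT : Matrix ι ι F × Matrix κ ι F, (g + if
        (isotropicMatrix α β γ AT.1 AT.2)ᵀ *ᵥ z = 0 then g * q ^ k else 0) :=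
        Finset.sum_le_sum fun AT _ => h2 AT
    _ = Fintype.card (Matrix ι ι F × Matrix κ ι F) * g + P.card * (g * q ^ k) := by
        rw [Finset.sum_add_distrib, ← Finset.sum_filter]
        simp only [Finset.sum_const, Finset.card_univ, smul_eq_mul, hP]
    _ ≤ Fintype.card (Matrix ι ι F × Matrix κ ι F) * g
        + P.card * (g * (q ^ (Fintype.card ι - 1) * q ^ 2)) := by gcongr
    _ = Fintype.card (Matrix ι ι F × Matrix κ ι F) * g
        + (P.card * q ^ (Fintype.card ι - 1)) * (g * q ^ 2) := by ring
    _ ≤ Fintype.card (Matrix ι ι F × Matrix κ ι F) * g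
        + Fintype.card (Matrix ι ι F × Matrix κ ι F) * (g * q ^ 2) := by gcongr
    _ = _ := by rw [Fintype.card_prod (_ × _)]; ring

end Ensemble

/-- Random coding bound: some member of an ensemble, in which each nonzero vector is hit with
probability at most `κ`, makes few errors when decoding to the heaviest vector of a coset. -/
theorem exists_sum_bad_le {Ω V : Type*} [Fintype Ω] [Nonempty Ω] [AddCommGroup V] [Fintype V]
    (D : Ω → V → Prop) (g : V → ℝ) (hg : ∀ y, 0 < g y) {Λ κ : ℝ} (hΛ : 0 < Λ)
    (hgΛ : ∑ y, g y ≤ Λ) (hκ : 0 < κ)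
    (hD : ∀ z, z ≠ 0 → (Nat.card {ω // D ω z} : ℝ) ≤ κ * Fintype.card Ω) :
    ∃ ω, ∑ y, Set.indicator {y | ∃ z, z ≠ 0 ∧ D ω z ∧ g y ≤ g (y - z)}
      (fun y => g y / min 1 (κ * Λ / g y)) y ≤ Λ := by
  classical
  have hΩ : (0 : ℝ) < Fintype.card Ω := by exact_mod_cast Fintype.card_pos
  have hb (y : V) : 0 < min 1 (κ * Λ / g y) := lt_min one_pos (by have := hg y; positivity)
  have hcount (y : V) : ∑ ω, Set.indicator {y | ∃ z, z ≠ 0 ∧ D ω z ∧ g y ≤ g (y - z)}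
      (fun _ => (1 : ℝ)) y ≤ Fintype.card Ω * min 1 (κ * Λ / g y) := by
    rw [mul_min_of_nonneg _ _ hΩ.le, mul_one]
    refine le_min ?_ ?_
    · refine (Finset.sum_le_sum (g := fun _ => (1 : ℝ)) fun ω _ => ?_).trans (by simp)
      exact Set.indicator_le_self' (by simp) _
    · have h1 (ω : Ω) : Set.indicator {y | ∃ z, z ≠ 0 ∧ D ω z ∧ g y ≤ g (y - z)}
          (fun _ => (1 : ℝ)) y ≤ ∑ z, if z ≠ 0 ∧ D ω z then g (y - z) / g y else 0 := by
        have hnn : ∀ z ∈ Finset.univ,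
            (0 : ℝ) ≤ if z ≠ 0 ∧ D ω z then g (y - z) / g y else 0 := fun z _ => by
          split_ifs
          · exact (div_pos (hg _) (hg _)).le
          · exact le_rfl
        refine Set.indicator_apply_le' ?_ fun _ => Finset.sum_nonneg hnn
        rintro ⟨z, hz, hDz, hle⟩
        refine le_trans ?_ (Finset.single_le_sum hnn (Finset.mem_univ z))
        rw [if_pos ⟨hz, hDz⟩, one_le_div (hg y)]
        exact hle
      calc _ ≤ ∑ ω, ∑ z, if z ≠ 0 ∧ D ω z then g (y - z) / g y else 0 :=
            Finset.sum_le_sum fun ω _ => h1 ω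
        _ = ∑ z, ∑ ω, if z ≠ 0 ∧ D ω z then g (y - z) / g y else 0 := Finset.sum_comm
        _ ≤ ∑ z, κ * Fintype.card Ω / g y * g (y - z) := Finset.sum_le_sum fun z _ => by
            have hgz := hg (y - z)
            have hgy := hg y
            by_cases hz : z = 0
            · simp only [hz, ne_eq, not_true_eq_false, false_and, if_false, Finset.sum_const_zero]
              rw [hz] at hgz
              positivity
            · simp only [ne_eq, hz, not_false_eq_true, true_and]
              rw [← Finset.sum_filter, Finset.sum_const, nsmul_eq_mul]
              have := hD z hz
              rw [Nat.card_eq_fintype_card, Fintype.card_subtype] at this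
              calc _ ≤ κ * Fintype.card Ω * (g (y - z) / g y) := by gcongr
                _ = _ := by ring
        _ = κ * Fintype.card Ω / g y * ∑ z, g z := by
            rw [← Finset.mul_sum, ← Equiv.sum_comp (Equiv.subLeft y) g]
            rfl
        _ ≤ κ * Fintype.card Ω / g y * Λ := by
            have hgy := hg y
            gcongr
        _ = _ := by ring
  have htot : ∑ ω, ∑ y, Set.indicator {y | ∃ z, z ≠ 0 ∧ D ω z ∧ g y ≤ g (y - z)}
      (fun y => g y / min 1 (κ * Λ / g y)) y ≤ ∑ _ω : Ω, Λ := by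
    rw [Finset.sum_comm]
    calc _ ≤ ∑ y, Fintype.card Ω * g y := Finset.sum_le_sum fun y _ => by
          have e (ω : Ω) : Set.indicator {y | ∃ z, z ≠ 0 ∧ D ω z ∧ g y ≤ g (y - z)}
              (fun y => g y / min 1 (κ * Λ / g y)) y = g y / min 1 (κ * Λ / g y) *
              Set.indicator {y | ∃ z, z ≠ 0 ∧ D ω z ∧ g y ≤ g (y - z)} (fun _ => (1 : ℝ)) y := by
            simp only [Set.indicator_apply]
            split_ifs <;> simp
          simp only [e]
          rw [← Finset.mul_sum]
          have hgy := hg y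
          have hby := hb y
          calc _ ≤ g y / min 1 (κ * Λ / g y) * (Fintype.card Ω * min 1 (κ * Λ / g y)) := by
                gcongr
                exact hcount y
            _ = _ := by field_simp
      _ = Fintype.card Ω * ∑ y, g y := by rw [Finset.mul_sum]
      _ ≤ Fintype.card Ω * Λ := by gcongr
      _ = _ := by simp
  obtain ⟨ω, -, hω⟩ := Finset.exists_le_of_sum_le Finset.univ_nonempty htot
  exact ⟨ω, hω⟩

section Types

/-- Empirical distribution of `y` on the coordinates in `S`. -/
def empDist {σ Y : Type*} [DecidableEq Y] (S : Finset σ) (y : σ → Y) : Y → ℝ :=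
  fun a => ((S.filter fun i => y i = a).card : ℝ) / S.card

variable {σ Y : Type*}

theorem sum_eq_card_mul_sum_empDist [Fintype Y] [DecidableEq Y] {S : Finset σ} (y : σ → Y) (g : Y → ℝ) :
    ∑ i ∈ S, g (y i) = S.card * ∑ a, empDist S y a * g a := by
  rcases S.eq_empty_or_nonempty with rfl | hS
  · simp
  have : (S.card : ℝ) ≠ 0 := by simpa using hS.ne_empty
  rw [← Finset.sum_fiberwise S y, Finset.mul_sum]
  refine Finset.sum_congr rfl fun a _ => ?_
  rw [Finset.sum_congr rfl (g := fun _ => g a) (by simp +contextual)]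
  simp only [Finset.sum_const, nsmul_eq_mul, empDist]
  field_simp

theorem isProbDist_empDist [Fintype Y] [DecidableEq Y] {S : Finset σ} (hS : S.Nonempty) (y : σ → Y) :
    IsProbDist (empDist S y) := by
  refine ⟨fun a => by unfold empDist; positivity, ?_⟩
  have := sum_eq_card_mul_sum_empDist (S := S) y fun _ => 1
  have h : (S.card : ℝ) ≠ 0 := by simpa using hS.ne_empty
  simp only [Finset.sum_const, nsmul_eq_mul, mul_one] at this
  exact mul_left_cancel₀ h (by rw [← this, mul_one])

theorem empDist_pos [DecidableEq Y] {S : Finset σ} (y : σ → Y) {i : σ} (hi : i ∈ S) :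
    0 < empDist S y (y i) := by
  have h1 : 0 < S.card := Finset.card_pos.mpr ⟨i, hi⟩
  have h2 : 0 < (S.filter fun j => y j = y i).card := Finset.card_pos.mpr ⟨i, by simp [hi]⟩
  unfold empDist
  positivity

theorem exists_mem_of_empDist_ne_zero [DecidableEq Y] {S : Finset σ} {y : σ → Y} {a : Y}
    (h : empDist S y a ≠ 0) : ∃ i ∈ S, y i = a := by
  by_contra! hc
  apply h
  simp [empDist, Finset.filter_eq_empty_iff.mpr fun i hi => hc i hi]

theorem prod_eq_rpow_entd_kld [Fintype Y] [DecidableEq Y] {d : ℕ} (hd : 1 < d) {S : Finset σ} (y : σ → Y)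
    {p : Y → ℝ} (hp : ∀ i ∈ S, 0 < p (y i)) :
    ∏ i ∈ S, p (y i)
      = (d : ℝ) ^ (-(S.card : ℝ) * (entd d (empDist S y) + kld d (empDist S y) p)) := by
  have hd' : (1 : ℝ) < d := by exact_mod_cast hd
  have key : -(S.card : ℝ) * (entd d (empDist S y) + kld d (empDist S y) p)
      = Real.logb d (∏ i ∈ S, p (y i)) := by
    rw [Real.logb_prod _ _ fun i hi => (hp i hi).ne', sum_eq_card_mul_sum_empDist y
      (fun a => Real.logb d (p a)), entd, kld, neg_mul, ← mul_neg, neg_add, neg_neg,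
      ← sub_eq_add_neg, ← Finset.sum_sub_distrib]
    congr 1
    refine Finset.sum_congr rfl fun a _ => ?_
    by_cases h : empDist S y a = 0
    · simp [h]
    · obtain ⟨i, hi, rfl⟩ := exists_mem_of_empDist_ne_zero h
      rw [Real.logb_div h (hp i hi).ne']
      ring
  rw [key, Real.rpow_logb (by linarith) hd'.ne' (Finset.prod_pos hp)]

theorem kld_self [Fintype Y] (d : ℕ) (Q : Y → ℝ) : kld d Q Q = 0 := by
  refine Finset.sum_eq_zero fun a _ => ?_
  by_cases h : Q a = 0 <;> simp [h]

theorem kld_nonneg [Fintype Y] {d : ℕ} (hd : 1 < d) {Q p : Y → ℝ} (hQ : IsProbDist Q) (hp : IsProbDist p)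
    (hac : ∀ a, p a = 0 → Q a = 0) : 0 ≤ kld d Q p := by
  have hl : 0 < Real.log d := Real.log_pos (by exact_mod_cast hd)
  have h (a : Y) : (Q a - p a) / Real.log d ≤ Q a * Real.logb d (Q a / p a) := by
    rw [Real.logb, ← mul_div_assoc]
    gcongr
    by_cases h0 : Q a = 0
    · simpa [h0] using hp.1 a
    · have hQa : 0 < Q a := lt_of_le_of_ne (hQ.1 a) (Ne.symm h0)
      have hpa : 0 < p a := lt_of_le_of_ne (hp.1 a) fun e => h0 (hac a e.symm)
      have := Real.one_sub_inv_le_log_of_pos (div_pos hQa hpa)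
      calc Q a - p a = Q a * (1 - (Q a / p a)⁻¹) := by field_simp
        _ ≤ _ := by gcongr
  calc (0 : ℝ) = ∑ a, (Q a - p a) / Real.log d := by
        rw [← Finset.sum_div, Finset.sum_sub_distrib, hQ.2, hp.2, sub_self, zero_div]
    _ ≤ _ := Finset.sum_le_sum fun a _ => h a

theorem sum_prod_ite_eq_one [Fintype Y] {n : ℕ} (c : Fin n → Prop) [DecidablePred c] {p q : Y → ℝ}
    (hp : IsProbDist p) (hq : IsProbDist q) :
    ∑ y : Fin n → Y, ∏ i, (if c i then p (y i) else q (y i)) = 1 := by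
  have := Finset.prod_univ_sum (fun _ : Fin n => (Finset.univ : Finset Y))
    (fun i a => if c i then p a else q a)
  rw [Fintype.piFinset_univ] at this
  rw [← this]
  refine Finset.prod_eq_one fun i _ => ?_
  split_ifs
  exacts [hp.2, hq.2]

/-- The first `ν` of `2ν` coordinates. -/
def firstHalf (ν : ℕ) : Finset (Fin (2 * ν)) := Finset.univ.filter fun i => (i : ℕ) < ν

/-- The last `ν` of `2ν` coordinates. -/
def secondHalf (ν : ℕ) : Finset (Fin (2 * ν)) := Finset.univ.filter fun i => ¬ (i : ℕ) < ν

theorem card_firstHalf (ν : ℕ) : (firstHalf ν).card = ν := by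
  rw [firstHalf, Fin.card_filter_val_lt]
  omega

theorem card_secondHalf (ν : ℕ) : (secondHalf ν).card = ν := by
  have := Finset.card_filter_add_card_filter_not (s := (Finset.univ : Finset (Fin (2 * ν))))
    fun i => (i : ℕ) < ν
  have h := card_firstHalf ν
  simp only [firstHalf, secondHalf, Finset.card_univ, Fintype.card_fin] at this h ⊢
  omega

/-- Probability of `y` under its own pair of types. -/
def typeWeight [DecidableEq Y] (ν : ℕ) (y : Fin (2 * ν) → Y) : ℝ :=
  ∏ i : Fin (2 * ν), if (i : ℕ) < ν then empDist (firstHalf ν) y (y i)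
    else empDist (secondHalf ν) y (y i)

theorem prod_halves_eq_rpow [Fintype Y] [DecidableEq Y] {d : ℕ} (hd : 1 < d) {ν : ℕ} (y : Fin (2 * ν) → Y) {p q : Y → ℝ}
    (hp : ∀ i ∈ firstHalf ν, 0 < p (y i)) (hq : ∀ i ∈ secondHalf ν, 0 < q (y i)) :
    ∏ i : Fin (2 * ν), (if (i : ℕ) < ν then p (y i) else q (y i))
      = (d : ℝ) ^ (-(ν : ℝ) * (entd d (empDist (firstHalf ν) y) + entd d (empDist (secondHalf ν) y)
        + (kld d (empDist (firstHalf ν) y) p + kld d (empDist (secondHalf ν) y) q))) := by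
  have h1 := prod_eq_rpow_entd_kld hd y hp
  have h2 := prod_eq_rpow_entd_kld hd y hq
  rw [card_firstHalf] at h1
  rw [card_secondHalf] at h2
  have hd' : (0 : ℝ) < d := by exact_mod_cast (by omega : 0 < d)
  rw [Finset.prod_ite]
  refine (congrArg₂ (· * ·) h1 h2).trans ?_
  rw [← Real.rpow_add hd']
  congr 1
  ring

theorem typeWeight_pos [DecidableEq Y] {ν : ℕ} (y : Fin (2 * ν) → Y) : 0 < typeWeight ν y := by
  refine Finset.prod_pos fun i _ => ?_
  split_ifs with h
  · exact empDist_pos y (by simp [firstHalf, h])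
  · exact empDist_pos y (by simpa [secondHalf] using h)

theorem typeWeight_eq_rpow [Fintype Y] [DecidableEq Y] {d : ℕ} (hd : 1 < d) {ν : ℕ} (y : Fin (2 * ν) → Y) :
    typeWeight ν y = (d : ℝ) ^ (-(ν : ℝ) *
      (entd d (empDist (firstHalf ν) y) + entd d (empDist (secondHalf ν) y))) := by
  have := prod_halves_eq_rpow hd y (fun i hi => empDist_pos y hi) (fun i hi => empDist_pos y hi)
  rwa [kld_self, kld_self, add_zero, add_zero] at this

theorem sum_typeWeight_le [Fintype Y] [DecidableEq Y] {ν : ℕ} (hν : 0 < ν) :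
    ∑ y : Fin (2 * ν) → Y, typeWeight ν y ≤ ((ν : ℝ) + 1) ^ (2 * Fintype.card Y) := by
  classical
  let t : (Fin (2 * ν) → Y) → (Y → Fin (ν + 1)) × (Y → Fin (ν + 1)) := fun y =>
    (fun a => Fin.ofNat (ν + 1) ((firstHalf ν).filter fun i => y i = a).card,
     fun a => Fin.ofNat (ν + 1) ((secondHalf ν).filter fun i => y i = a).card)
  have hS1 : (firstHalf ν).Nonempty := Finset.card_pos.mp (by rwa [card_firstHalf])
  have hS2 : (secondHalf ν).Nonempty := Finset.card_pos.mp (by rwa [card_secondHalf])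
  have ht {y y' : Fin (2 * ν) → Y} (h : t y = t y') :
      empDist (firstHalf ν) y = empDist (firstHalf ν) y' ∧
      empDist (secondHalf ν) y = empDist (secondHalf ν) y' := by
    have hlt {S : Finset (Fin (2 * ν))} (hS : S.card = ν) (y : Fin (2 * ν) → Y) (a : Y) :
        (S.filter fun i => y i = a).card < ν + 1 :=
      Nat.lt_succ_of_le ((Finset.card_filter_le _ _).trans hS.le)
    constructor <;> ext a <;> unfold empDist <;> congr 2
    · have := congrArg Fin.val (congrFun (congrArg Prod.fst h) a)
      simpa only [t, Fin.val_ofNat, Nat.mod_eq_of_lt (hlt (card_firstHalf ν) _ a)] using this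
    · have := congrArg Fin.val (congrFun (congrArg Prod.snd h) a)
      simpa only [t, Fin.val_ofNat, Nat.mod_eq_of_lt (hlt (card_secondHalf ν) _ a)] using this
  rw [← Finset.sum_fiberwise Finset.univ t]
  calc _ ≤ ∑ _j : (Y → Fin (ν + 1)) × (Y → Fin (ν + 1)), (1 : ℝ) :=
        Finset.sum_le_sum fun j _ => ?_
    _ = _ := by simp [two_mul, pow_add]
  by_cases hj : ∃ y₀, t y₀ = j
  · obtain ⟨y₀, rfl⟩ := hj
    have hP := isProbDist_empDist hS1 y₀
    have hQ := isProbDist_empDist hS2 y₀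
    rw [← sum_prod_ite_eq_one (fun i : Fin (2 * ν) => (i : ℕ) < ν) hP hQ]
    calc _ = ∑ y ∈ Finset.univ.filter fun y => t y = t y₀, ∏ i : Fin (2 * ν),
          (if (i : ℕ) < ν then empDist (firstHalf ν) y₀ (y i)
            else empDist (secondHalf ν) y₀ (y i)) := by
          refine Finset.sum_congr rfl fun y hy => ?_
          obtain ⟨h1, h2⟩ := ht (Finset.mem_filter.mp hy).2
          rw [typeWeight, h1, h2]
      _ ≤ _ := Finset.sum_le_sum_of_subset_of_nonneg (Finset.filter_subset _ _) fun y _ _ =>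
          Finset.prod_nonneg fun i _ => by
            split_ifs
            exacts [hP.1 _, hQ.1 _]
  · rw [Finset.filter_eq_empty_iff.mpr fun y _ h => hj ⟨y, h⟩]
    simp

end Types

theorem EstarC_le {d : ℕ} [NeZero d] (hd : 1 < d) (R : ℝ) {p₀ p₁ Q₀ Q₁ : ZMod d → ℝ}
    (hp₀ : IsProbDist p₀) (hp₁ : IsProbDist p₁) (hQ₀ : IsProbDist Q₀) (hQ₁ : IsProbDist Q₁)
    (h₀ : ∀ a, p₀ a = 0 → Q₀ a = 0) (h₁ : ∀ a, p₁ a = 0 → Q₁ a = 0) :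
    EstarC d R p₀ p₁
      ≤ 2⁻¹ * (kld d Q₀ p₀ + kld d Q₁ p₁ + max (1 - (entd d Q₀ + entd d Q₁) - R) 0) := by
  refine csInf_le ⟨0, ?_⟩ ⟨Q₀, Q₁, hQ₀, hQ₁, h₀, h₁, rfl⟩
  rintro v ⟨Q₀, Q₁, hQ₀, hQ₁, h₀, h₁, rfl⟩
  have := kld_nonneg hd hQ₀ hp₀ h₀
  have := kld_nonneg hd hQ₁ hp₁ h₁
  have := le_max_right (1 - (entd d Q₀ + entd d Q₁) - R) 0
  positivity

theorem prod_mul_min_le {d : ℕ} [NeZero d] (hd : 1 < d) {R κ Λ c : ℝ} {ν : ℕ} (hν : 0 < ν)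
    (hc : 1 ≤ c) (hκ : κ * Λ ≤ c * (d : ℝ) ^ (-(ν : ℝ) * (1 - R)))
    {p q : ZMod d → ℝ} (hp : IsProbDist p) (hq : IsProbDist q) (y : Fin (2 * ν) → ZMod d) :
    (∏ i : Fin (2 * ν), (if (i : ℕ) < ν then p (y i) else q (y i)))
        * min 1 (κ * Λ / typeWeight ν y)
      ≤ c * (d : ℝ) ^ (-(2 * (ν : ℝ)) * EstarC d R p q) * typeWeight ν y := by
  have hd0 : (0 : ℝ) < d := by exact_mod_cast (by omega : 0 < d)
  have hd1 : (1 : ℝ) ≤ d := by exact_mod_cast hd.le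
  have hg := typeWeight_pos y
  by_cases h0 : ∃ i : Fin (2 * ν), (if (i : ℕ) < ν then p (y i) else q (y i)) = 0
  · obtain ⟨i, hi⟩ := h0
    rw [Finset.prod_eq_zero (Finset.mem_univ i) hi, zero_mul]
    positivity
  push Not at h0
  have hP : ∀ i ∈ firstHalf ν, 0 < p (y i) := fun i hi => by
    have := h0 i
    rw [if_pos (by simpa [firstHalf] using hi)] at this
    exact lt_of_le_of_ne (hp.1 _) this.symm
  have hQ : ∀ i ∈ secondHalf ν, 0 < q (y i) := fun i hi => by
    have := h0 i
    rw [if_neg (by simpa [secondHalf] using hi)] at this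
    exact lt_of_le_of_ne (hq.1 _) this.symm
  have hS1 : (firstHalf ν).Nonempty := Finset.card_pos.mp (by rwa [card_firstHalf])
  have hS2 : (secondHalf ν).Nonempty := Finset.card_pos.mp (by rwa [card_secondHalf])
  have hE := EstarC_le hd R hp hq (isProbDist_empDist hS1 y) (isProbDist_empDist hS2 y)
    (fun a ha => by
      by_contra h
      obtain ⟨i, hi, rfl⟩ := exists_mem_of_empDist_ne_zero h
      exact (hP i hi).ne' ha)
    (fun a ha => by
      by_contra h
      obtain ⟨i, hi, rfl⟩ := exists_mem_of_empDist_ne_zero h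
      exact (hQ i hi).ne' ha)
  have hprod := prod_halves_eq_rpow hd y hP hQ
  have hw := typeWeight_eq_rpow hd y
  set H := entd d (empDist (firstHalf ν) y) + entd d (empDist (secondHalf ν) y)
  set D := kld d (empDist (firstHalf ν) y) p + kld d (empDist (secondHalf ν) y) q
  set M := max (1 - H - R) 0 with hM
  have hmin : min 1 (κ * Λ / typeWeight ν y) ≤ c * (d : ℝ) ^ (-(ν : ℝ) * M) := by
    rcases le_total (1 - H - R) 0 with hx | hx
    · rw [hM, max_eq_right hx, mul_zero, Real.rpow_zero, mul_one]
      exact (min_le_left _ _).trans hc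
    · rw [hM, max_eq_left hx]
      refine (min_le_right _ _).trans ?_
      rw [div_le_iff₀ hg, hw, mul_assoc, ← Real.rpow_add hd0]
      refine hκ.trans (le_of_eq ?_)
      congr 2
      ring
  calc _ ≤ (d : ℝ) ^ (-(ν : ℝ) * (H + D)) * (c * (d : ℝ) ^ (-(ν : ℝ) * M)) := by
        rw [hprod]
        gcongr
    _ = c * (d : ℝ) ^ (-(ν : ℝ) * (D + M)) * typeWeight ν y := by
        rw [hw, mul_left_comm, ← Real.rpow_add hd0, mul_assoc, ← Real.rpow_add hd0]
        congr 2
        ring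
    _ ≤ _ := by
        gcongr ?_ * ?_ * _
        refine Real.rpow_le_rpow_of_exponent_le hd1 ?_
        have : (0 : ℝ) ≤ ν := by positivity
        nlinarith

/-- Decoding each coset of the dual code to an element of maximal weight `g`. -/
theorem exists_transversal {d n : ℕ} [NeZero d] (C : Submodule (ZMod d) (Fin n → ZMod d))
    (g : (Fin n → ZMod d) → ℝ) :
    ∃ Γ : Set (Fin n → ZMod d), IsTransversal (C : Set (Fin n → ZMod d)) Γ ∧
      {w | ∃ γ ∈ Γ, ∃ c ∈ C, w = γ + c}ᶜ ⊆
        {y | ∃ z, z ≠ 0 ∧ z ∈ dualSet (C : Set (Fin n → ZMod d)) ∧ g y ≤ g (y - z)} := by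
  let D : AddSubgroup (Fin n → ZMod d) :=
    { carrier := dualSet (C : Set (Fin n → ZMod d))
      zero_mem' := fun x _ => by simp [dotp]
      add_mem' := fun {a b} ha hb x hx => by
        have h1 := ha x hx
        have h2 := hb x hx
        simp only [dotp] at h1 h2 ⊢
        simp [mul_add, Finset.sum_add_distrib, h1, h2]
      neg_mem' := fun {a} ha x hx => by
        have h1 := ha x hx
        simp only [dotp] at h1 ⊢
        simp [h1] }
  have hmem (z : Fin n → ZMod d) : z ∈ D ↔ z ∈ dualSet (C : Set (Fin n → ZMod d)) := Iff.rfl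
  have hex (q : (Fin n → ZMod d) ⧸ D) : ∃ γ : Fin n → ZMod d, (γ : (Fin n → ZMod d) ⧸ D) = q ∧
      ∀ y : Fin n → ZMod d, (y : (Fin n → ZMod d) ⧸ D) = q → g y ≤ g γ := by
    obtain ⟨y₀, hy₀⟩ := QuotientAddGroup.mk_surjective q
    obtain ⟨γ, h1, h2⟩ := Set.exists_max_image {y : Fin n → ZMod d | (y : _ ⧸ D) = q} g
      (Set.toFinite _) ⟨y₀, hy₀⟩
    exact ⟨γ, h1, h2⟩
  choose rep hrep hmax using hex
  refine ⟨Set.range rep, fun y => ⟨rep y, ⟨⟨_, rfl⟩, ?_⟩, ?_⟩, fun y hy => ?_⟩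
  · rw [← hmem, ← neg_mem_iff, neg_sub, sub_eq_neg_add]
    exact QuotientAddGroup.eq.mp (hrep y).symm
  · rintro _ ⟨⟨q, rfl⟩, h⟩
    rw [← hmem, sub_eq_neg_add] at h
    have := QuotientAddGroup.eq.mpr h
    rw [hrep] at this
    rw [this]
  · refine ⟨y - rep y, fun h0 => hy ⟨rep y, ⟨_, rfl⟩, 0, C.zero_mem, ?_⟩, ?_, ?_⟩
    · rw [add_zero]
      exact sub_eq_zero.mp h0
    · rw [← hmem, sub_eq_neg_add]
      exact QuotientAddGroup.eq.mp (hrep y)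
    · rw [sub_sub_cancel]
      exact hmax _ _ rfl

theorem isProbDist_margin1 {Y : Type*} [Fintype Y] {P : Y × Y → ℝ} (h : IsProbDist P) :
    IsProbDist (margin1 P) :=
  ⟨fun a => Finset.sum_nonneg fun _ _ => h.1 _, by
    rw [← h.2, Fintype.sum_prod_type]
    rfl⟩

theorem isProbDist_margin2 {Y : Type*} [Fintype Y] {P : Y × Y → ℝ} (h : IsProbDist P) :
    IsProbDist (margin2 P) :=
  ⟨fun a => Finset.sum_nonneg fun _ _ => h.1 _, by
    rw [← h.2, Fintype.sum_prod_type_right]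
    rfl⟩

/-- A self-orthogonal code whose dual has few vectors confusable with one of larger weight. -/
theorem exists_code {d : ℕ} [NeZero d] (hd : d.Prime) (hd3 : 3 ≤ d) {ν k : ℕ} (hν : 2 ≤ ν)
    (hk : k ≤ ν) :
    ∃ C : Submodule (ZMod d) (Fin (2 * ν) → ZMod d),
      (C : Set (Fin (2 * ν) → ZMod d)) ⊆ dualSet (C : Set (Fin (2 * ν) → ZMod d)) ∧
      Module.finrank (ZMod d) C ≤ k ∧
      ∑ y : Fin (2 * ν) → ZMod d, Set.indicator {y | ∃ z, z ≠ 0 ∧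
          z ∈ dualSet (C : Set (Fin (2 * ν) → ZMod d)) ∧ typeWeight ν y ≤ typeWeight ν (y - z)}
        (fun y => typeWeight ν y / min 1 ((((d : ℝ) ^ 2 + 1) / (d : ℝ) ^ k)
          * ((ν : ℝ) + 1) ^ (2 * d) / typeWeight ν y)) y ≤ ((ν : ℝ) + 1) ^ (2 * d) := by
  have : Fact d.Prime := ⟨hd⟩
  have h2 : (2 : ZMod d) ≠ 0 := by
    intro h
    have : ((2 : ℕ) : ZMod d) = 0 := by exact_mod_cast h
    rw [ZMod.natCast_eq_zero_iff] at this
    exact absurd (Nat.le_of_dvd two_pos this) (by omega)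
  obtain ⟨α, β, γ, hfr⟩ := exists_isHyperbolicFrame h2 (ZMod.sq_add_sq d (-1)) (ν / 2)
    (2 * (ν % 2)) (2 * ν) (by omega)
  let Ω := (Matrix (Fin (ν / 2) × Fin 2) (Fin (ν / 2) × Fin 2) (ZMod d) ×
    Matrix (Fin (2 * (ν % 2))) (Fin (ν / 2) × Fin 2) (ZMod d)) ×
    Matrix (Fin (ν / 2) × Fin 2) (Fin k) (ZMod d)
  let N : Ω → Matrix (Fin (2 * ν)) (Fin k) (ZMod d) := fun ω =>
    isotropicMatrix α β γ ω.1.1 ω.1.2 * ω.2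
  let code : Ω → Submodule (ZMod d) (Fin (2 * ν) → ZMod d) := fun ω =>
    LinearMap.range (N ω).mulVecLin
  have hdual (ω : Ω) (z : Fin (2 * ν) → ZMod d) :
      z ∈ dualSet (code ω : Set (Fin (2 * ν) → ZMod d)) ↔ (N ω)ᵀ *ᵥ z = 0 := by
    have hdot (u : Fin k → ZMod d) : dotp (N ω *ᵥ u) z = u ⬝ᵥ ((N ω)ᵀ *ᵥ z) := by
      rw [dotProduct_mulVec, vecMul_transpose]
      rfl
    constructor
    · intro h
      refine dotProduct_eq_zero _ fun u => ?_
      rw [dotProduct_comm, ← hdot]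
      exact h _ ⟨u, rfl⟩
    · rintro h _ ⟨u, rfl⟩
      rw [mulVecLin_apply, hdot, h, dotProduct_zero]
  have hd0 : (0 : ℝ) < d := by exact_mod_cast hd.pos
  obtain ⟨ω, hω⟩ := exists_sum_bad_le (Ω := Ω)
    (fun ω z => z ∈ dualSet (code ω : Set (Fin (2 * ν) → ZMod d))) (typeWeight ν)
    typeWeight_pos (Λ := ((ν : ℝ) + 1) ^ (2 * d)) (κ := ((d : ℝ) ^ 2 + 1) / (d : ℝ) ^ k)
    (by positivity) (by simpa [ZMod.card] using sum_typeWeight_le (Y := ZMod d) (by omega : 0 < ν))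
    (by positivity) (fun z hz => by
      have := hfr.card_code_le hz (k := k) (by simp; omega)
      rw [ZMod.card] at this
      simp only [hdual]
      rw [Nat.card_eq_fintype_card, Fintype.card_subtype, div_mul_eq_mul_div,
        le_div_iff₀ (by positivity)]
      exact_mod_cast this)
  refine ⟨code ω, ?_, ?_, hω⟩
  · rintro _ ⟨u, rfl⟩
    rw [hdual, mulVecLin_apply, mulVec_mulVec, Matrix.transpose_mul, Matrix.mul_assoc,
      ← Matrix.mul_assoc _ _ ω.2, hfr.isotropicMatrix_transpose_mul_self h2]
    simp
  · simpa using LinearMap.finrank_range_le (N ω).mulVecLin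

theorem pn2_le {d : ℕ} [NeZero d] (hd : 1 < d) {R κ Λ c E : ℝ} {ν : ℕ} (hν : 0 < ν)
    (hκ0 : 0 < κ) (hΛ : 0 < Λ) (hc : 1 ≤ c) (hκ : κ * Λ ≤ c * (d : ℝ) ^ (-(ν : ℝ) * (1 - R)))
    {p q : ZMod d → ℝ} (hp : IsProbDist p) (hq : IsProbDist q) (hE : E ≤ EstarC d R p q)
    {S B : Set (Fin (2 * ν) → ZMod d)} (hSB : S ⊆ B)
    (hB : ∑ y : Fin (2 * ν) → ZMod d, Set.indicator B
      (fun y => typeWeight ν y / min 1 (κ * Λ / typeWeight ν y)) y ≤ Λ) :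
    pn2 ν p q S ≤ c * Λ * (d : ℝ) ^ (-(2 * (ν : ℝ)) * E) := by
  classical
  have hd0 : (0 : ℝ) < d := by exact_mod_cast (by omega : 0 < d)
  have hd1 : (1 : ℝ) ≤ d := by exact_mod_cast hd.le
  calc pn2 ν p q S ≤ ∑ y : Fin (2 * ν) → ZMod d, c * (d : ℝ) ^ (-(2 * (ν : ℝ)) * E) *
        Set.indicator B (fun y => typeWeight ν y / min 1 (κ * Λ / typeWeight ν y)) y := by
        refine Finset.sum_le_sum fun y _ => ?_
        have hg := typeWeight_pos y
        have hb : 0 < min 1 (κ * Λ / typeWeight ν y) := lt_min one_pos (by positivity)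
        split_ifs with h
        · rw [Set.indicator_of_mem (hSB h), ← mul_div_assoc, le_div_iff₀ hb]
          refine (prod_mul_min_le hd hν hc hκ hp hq y).trans ?_
          gcongr ?_ * ?_ * _
          refine Real.rpow_le_rpow_of_exponent_le hd1 ?_
          have : (0 : ℝ) ≤ ν := by positivity
          nlinarith
        · refine mul_nonneg (by positivity) (Set.indicator_nonneg (fun y _ => ?_) y)
          have hg := typeWeight_pos y
          positivity
    _ ≤ c * (d : ℝ) ^ (-(2 * (ν : ℝ)) * E) * Λ := by
        rw [← Finset.mul_sum]
        gcongr
    _ = _ := by ring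

theorem stmt_12 (d : ℕ) [NeZero d] (hd : d.Prime) (hd3 : 3 ≤ d)
    (R : ℝ) (hR0 : 0 ≤ R) (hR1 : R ≤ 1) :
    ∃ (f : Polynomial ℝ) (ν₀ : ℕ), ∀ ν : ℕ, ν₀ ≤ ν →
      ∃ (C : Submodule (ZMod d) (Fin (2 * ν) → ZMod d)) (Γ : Set (Fin (2 * ν) → ZMod d)),
        (C : Set (Fin (2 * ν) → ZMod d)) ⊆ dualSet (C : Set (Fin (2 * ν) → ZMod d)) ∧
        2 * (ν : ℝ) - 2 * (Module.finrank (ZMod d) C : ℝ) ≥ 2 * (ν : ℝ) * R ∧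
        IsTransversal (C : Set (Fin (2 * ν) → ZMod d)) Γ ∧
        ∀ P₀ P₁ : ZMod d × ZMod d → ℝ, IsProbDist P₀ → IsProbDist P₁ →
          pn2 ν (margin1 P₀) (margin1 P₁)
              {w | ∃ γ ∈ Γ, ∃ c ∈ C, w = γ + c}ᶜ +
          pn2 ν (margin2 P₀) (margin2 P₁)
              {w | ∃ γ ∈ Γ, ∃ c ∈ C, w = γ + c}ᶜ ≤
            f.eval (ν : ℝ) * (d : ℝ) ^ (-(2 * (ν : ℝ)) * Ec d R P₀ P₁) := by
  have hd1 : 1 < d := by omega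
  have hd0 : (0 : ℝ) < d := by exact_mod_cast hd.pos
  have hd1' : (1 : ℝ) ≤ d := by exact_mod_cast hd1.le
  refine ⟨Polynomial.C (2 * (((d : ℝ) ^ 2 + 1) * d)) * (Polynomial.X + 1) ^ (4 * d), 2,
    fun ν hν => ?_⟩
  have hν0 : (0 : ℝ) ≤ ν := by positivity
  have hfl := Nat.floor_le (mul_nonneg hν0 (sub_nonneg.mpr hR1))
  have hfl' := (Nat.lt_floor_add_one ((ν : ℝ) * (1 - R))).le
  set k := ⌊(ν : ℝ) * (1 - R)⌋₊
  have hk : k ≤ ν := by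
    have : (k : ℝ) ≤ ν := by nlinarith
    exact_mod_cast this
  obtain ⟨C, hself, hrank, hsum⟩ := exists_code hd hd3 hν hk
  obtain ⟨Γ, hΓ, hbad⟩ := exists_transversal C (typeWeight ν)
  have hrank' : (Module.finrank (ZMod d) C : ℝ) ≤ k := by exact_mod_cast hrank
  refine ⟨C, Γ, hself, by nlinarith, hΓ, fun P₀ P₁ hP₀ hP₁ => ?_⟩
  set Λ : ℝ := ((ν : ℝ) + 1) ^ (2 * d) with hΛ
  have hΛ1 : 1 ≤ Λ := one_le_pow₀ (by linarith)
  set κ : ℝ := ((d : ℝ) ^ 2 + 1) / (d : ℝ) ^ k with hκ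
  set c : ℝ := ((d : ℝ) ^ 2 + 1) * d * Λ with hc
  have hκ0 : 0 < κ := by positivity
  have hc1 : 1 ≤ c :=
    one_le_mul_of_one_le_of_one_le (one_le_mul_of_one_le_of_one_le (by nlinarith) hd1') hΛ1
  have hκc : κ * Λ ≤ c * (d : ℝ) ^ (-(ν : ℝ) * (1 - R)) := by
    have : ((d : ℝ) ^ k)⁻¹ ≤ d * (d : ℝ) ^ (-(ν : ℝ) * (1 - R)) := by
      nth_rewrite 2 [← Real.rpow_one (d : ℝ)]
      rw [← Real.rpow_natCast, ← Real.rpow_neg hd0.le, ← Real.rpow_add hd0]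
      exact Real.rpow_le_rpow_of_exponent_le hd1' (by linarith)
    calc κ * Λ = ((d : ℝ) ^ 2 + 1) * Λ * ((d : ℝ) ^ k)⁻¹ := by rw [hκ]; ring
      _ ≤ ((d : ℝ) ^ 2 + 1) * Λ * (d * (d : ℝ) ^ (-(ν : ℝ) * (1 - R))) := by gcongr
      _ = _ := by rw [hc]; ring
  have h1 := pn2_le (E := Ec d R P₀ P₁) hd1 (by omega) hκ0 (by linarith) hc1 hκc (isProbDist_margin1 hP₀)
    (isProbDist_margin1 hP₁) (min_le_left _ _) hbad hsum
  have h2 := pn2_le (E := Ec d R P₀ P₁) hd1 (by omega) hκ0 (by linarith) hc1 hκc (isProbDist_margin2 hP₀)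
    (isProbDist_margin2 hP₁) (min_le_right _ _) hbad hsum
  refine (add_le_add h1 h2).trans (le_of_eq ?_)
  simp only [Polynomial.eval_mul, Polynomial.eval_C, Polynomial.eval_pow, Polynomial.eval_add,
    Polynomial.eval_X, Polynomial.eval_one]
  rw [hc, hΛ, show 4 * d = 2 * d + 2 * d by ring, pow_add]
  ring

end
end
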